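/- Let f : ℝ^d → ℝ be convex, twice continuously differentiable with positive definite Hessian everywhere, semi-strongly self-concordant with constant L_semi > 0, and let x* be a global minimizer of f. Fix α > 0, θ := 1 + α, and L ≥ (1 + ᾱ)^{3/2} L_semi, and for each j ≥ 0 let B_j be an (α̲, ᾱ)-relative inexact Hessian of f at x_j with α ≥ max(α̲, ᾱ), where the iterates are generated by the CEQN step x_{j+1} := x_j − η_j B_j⁻¹ ∇f(x_j) with η_j the unique positive solution of L η_j² ‖∇f(x_j)‖_{B_j}^* + θ η_j = 1. Let k ≥ 1, suppose ‖∇f(x_{j+1})‖_{B_j}^* ≥ (8/3) α² / L for all j ∈ {0, …, k}, and let D̄ > 0 satisfy ‖x_j − x*‖_{B_j} + ‖∇f(x_j)‖_{B_j}^* ≤ D̄ for all j ∈ {0, …, k+1}. Then f(x_{k+1}) − f(x*) ≤ 486 L D̄³ / k². -/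

import Mathlib

open scoped RealInnerProductSpace

/-- The action of a `d × d` matrix on a vector of `EuclideanSpace ℝ (Fin d)`. -/
noncomputable def mulV {d : ℕ} (B : Matrix (Fin d) (Fin d) ℝ)
    (v : EuclideanSpace ℝ (Fin d)) : EuclideanSpace ℝ (Fin d) :=
  (EuclideanSpace.equiv (Fin d) ℝ).symm (B.mulVec ((EuclideanSpace.equiv (Fin d) ℝ) v))

/-- The `B`-norm `‖h‖_B = ⟨h, B h⟩^{1/2}`. -/
noncomputable def normB {d : ℕ} (B : Matrix (Fin d) (Fin d) ℝ)
    (h : EuclideanSpace ℝ (Fin d)) : ℝ :=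
  Real.sqrt ⟪h, mulV B h⟫

/-- The dual norm `‖g‖_B^* = ⟨g, B⁻¹ g⟩^{1/2}`. -/
noncomputable def dualNormB {d : ℕ} (B : Matrix (Fin d) (Fin d) ℝ)
    (g : EuclideanSpace ℝ (Fin d)) : ℝ :=
  Real.sqrt ⟪g, mulV B⁻¹ g⟫

/-- The Hessian of `f` at `x`, as a `d × d` matrix (matrix of the Fréchet derivative
of the gradient). -/
noncomputable def hessM {d : ℕ} (f : EuclideanSpace ℝ (Fin d) → ℝ)
    (x : EuclideanSpace ℝ (Fin d)) : Matrix (Fin d) (Fin d) ℝ :=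
  fun i j => (fderiv ℝ (gradient f) x (EuclideanSpace.single j (1 : ℝ))) i

/-- `f` is semi-strongly self-concordant with constant `Ls`:
`‖(∇²f(y) − ∇²f(x)) h‖_{∇²f(x)}^* ≤ Ls ‖y − x‖_{∇²f(x)} ‖h‖_{∇²f(x)}` for all `x y h`. -/
def SemiStrongSelfConcordant {d : ℕ} (f : EuclideanSpace ℝ (Fin d) → ℝ) (Ls : ℝ) : Prop :=
  ∀ x y h : EuclideanSpace ℝ (Fin d),
    dualNormB (hessM f x) (mulV (hessM f y - hessM f x) h) ≤
      Ls * normB (hessM f x) (y - x) * normB (hessM f x) h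

/-- `Bx` is an `(al, au)`-relative inexact Hessian of `f` at `x`:
`Bx` is symmetric positive definite, `0 ≤ al ≤ 1`, `0 ≤ au`, and
`(1 − al) Bx ⪯ ∇²f(x) ⪯ (1 + au) Bx` in the Loewner order. -/
def RelInexactHessian {d : ℕ} (f : EuclideanSpace ℝ (Fin d) → ℝ)
    (x : EuclideanSpace ℝ (Fin d)) (al au : ℝ) (Bx : Matrix (Fin d) (Fin d) ℝ) : Prop :=
  0 ≤ al ∧ al ≤ 1 ∧ 0 ≤ au ∧ Bx.PosDef ∧
    (hessM f x - (1 - al) • Bx).PosSemidef ∧ ((1 + au) • Bx - hessM f x).PosSemidef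

/-- The inexact second-order model
`Q̄_f(y;x) = f(x) + ⟨∇f(x), y − x⟩ + ½⟨B_x(y − x), y − x⟩`. -/
noncomputable def Qbar {d : ℕ} (f : EuclideanSpace ℝ (Fin d) → ℝ)
    (Bx : Matrix (Fin d) (Fin d) ℝ) (x y : EuclideanSpace ℝ (Fin d)) : ℝ :=
  f x + ⟪gradient f x, y - x⟫ + (1 / 2) * ⟪mulV Bx (y - x), y - x⟫

section helpers
variable {d : ℕ}

lemma mulV_def (A : Matrix (Fin d) (Fin d) ℝ) (v : EuclideanSpace ℝ (Fin d)) :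
    mulV A v = WithLp.toLp 2 (A.mulVec v.ofLp) := rfl

lemma mulV_add (A : Matrix (Fin d) (Fin d) ℝ) (u v : EuclideanSpace ℝ (Fin d)) :
    mulV A (u + v) = mulV A u + mulV A v := by
  simp [mulV, Matrix.mulVec_add]

lemma mulV_sub (A : Matrix (Fin d) (Fin d) ℝ) (u v : EuclideanSpace ℝ (Fin d)) :
    mulV A (u - v) = mulV A u - mulV A v := by
  simp [mulV, Matrix.mulVec_sub]

lemma mulV_smul (A : Matrix (Fin d) (Fin d) ℝ) (c : ℝ) (v : EuclideanSpace ℝ (Fin d)) :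
    mulV A (c • v) = c • mulV A v := by
  simp [mulV, Matrix.mulVec_smul]

lemma mulV_sub_mat (A B : Matrix (Fin d) (Fin d) ℝ) (v : EuclideanSpace ℝ (Fin d)) :
    mulV (A - B) v = mulV A v - mulV B v := by
  simp [mulV, Matrix.sub_mulVec]

lemma mulV_smul_mat (c : ℝ) (A : Matrix (Fin d) (Fin d) ℝ) (v : EuclideanSpace ℝ (Fin d)) :
    mulV (c • A) v = c • mulV A v := by
  simp [mulV, Matrix.smul_mulVec]

lemma mulV_mul (A B : Matrix (Fin d) (Fin d) ℝ) (v : EuclideanSpace ℝ (Fin d)) :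
    mulV (A * B) v = mulV A (mulV B v) := by
  simp [mulV_def, Matrix.mulVec_mulVec]

lemma mulV_one (v : EuclideanSpace ℝ (Fin d)) :
    mulV (1 : Matrix (Fin d) (Fin d) ℝ) v = v := by
  simp [mulV]

lemma inner_mulV (A : Matrix (Fin d) (Fin d) ℝ) (u v : EuclideanSpace ℝ (Fin d)) :
    ⟪u, mulV A v⟫ = ⟪mulV A.transpose u, v⟫ := by
  simp only [mulV_def, EuclideanSpace.inner_eq_star_dotProduct]
  simp [Matrix.mulVec_transpose, Matrix.dotProduct_mulVec, dotProduct_comm]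

lemma psd_nonneg {A : Matrix (Fin d) (Fin d) ℝ} (hA : A.PosSemidef)
    (v : EuclideanSpace ℝ (Fin d)) : 0 ≤ ⟪v, mulV A v⟫ := by
  have := hA.dotProduct_mulVec_nonneg (v.ofLp)
  simp only [mulV_def, EuclideanSpace.inner_eq_star_dotProduct]
  simpa [dotProduct_comm] using this

open scoped MatrixOrder in
lemma exists_factor {B : Matrix (Fin d) (Fin d) ℝ} (hB : B.PosDef) :
    ∃ S T : Matrix (Fin d) (Fin d) ℝ, B = S.transpose * S ∧ B⁻¹ = T.transpose * T ∧
      T * S.transpose = 1 ∧ S.transpose * T = 1 := by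
  have h0 : (0 : Matrix (Fin d) (Fin d) ℝ) ≤ B := hB.posSemidef.nonneg
  have h1 : CFC.sqrt B * CFC.sqrt B = B := CFC.sqrt_mul_sqrt_self B h0
  have h2 : (CFC.sqrt B).transpose = CFC.sqrt B := by
    have : IsSelfAdjoint (CFC.sqrt B) := (CFC.sqrt_nonneg B).isSelfAdjoint
    have h := this.star_eq
    rw [Matrix.star_eq_conjTranspose, Matrix.conjTranspose_eq_transpose_of_trivial] at h
    exact h
  have hu : IsUnit B.det := (Matrix.isUnit_iff_isUnit_det _).1 hB.isUnit
  have hu2 : IsUnit (CFC.sqrt B).det := by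
    rw [← h1, Matrix.det_mul] at hu
    exact isUnit_of_mul_isUnit_left hu
  refine ⟨CFC.sqrt B, (CFC.sqrt B)⁻¹, ?_, ?_, ?_, ?_⟩
  · rw [h2, h1]
  · rw [Matrix.transpose_nonsing_inv, h2, ← Matrix.mul_inv_rev, h1]
  · rw [h2, Matrix.nonsing_inv_mul _ hu2]
  · rw [h2, Matrix.mul_nonsing_inv _ hu2]

lemma normB_eq {B S : Matrix (Fin d) (Fin d) ℝ} (h : B = S.transpose * S)
    (v : EuclideanSpace ℝ (Fin d)) : normB B v = ‖mulV S v‖ := by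
  rw [normB, h, mulV_mul, inner_mulV, Matrix.transpose_transpose, real_inner_self_eq_norm_sq,
    Real.sqrt_sq (norm_nonneg _)]

lemma dualNormB_eq {B T : Matrix (Fin d) (Fin d) ℝ} (h : B⁻¹ = T.transpose * T)
    (v : EuclideanSpace ℝ (Fin d)) : dualNormB B v = ‖mulV T v‖ := normB_eq h v

/-- Everything about the `B`-norms, packaged with linear factors. -/
lemma normB_sq {B : Matrix (Fin d) (Fin d) ℝ} (hB : B.PosSemidef)
    (v : EuclideanSpace ℝ (Fin d)) : normB B v ^ 2 = ⟪v, mulV B v⟫ :=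
  Real.sq_sqrt (psd_nonneg hB v)

lemma dualNormB_sq {B : Matrix (Fin d) (Fin d) ℝ} (hB : B.PosDef)
    (v : EuclideanSpace ℝ (Fin d)) : dualNormB B v ^ 2 = ⟪v, mulV B⁻¹ v⟫ :=
  Real.sq_sqrt (psd_nonneg hB.inv.posSemidef v)

lemma inner_factor {S T : Matrix (Fin d) (Fin d) ℝ} (h : S.transpose * T = 1)
    (u v : EuclideanSpace ℝ (Fin d)) : ⟪mulV T u, mulV S v⟫ = ⟪u, v⟫ := by
  rw [inner_mulV, ← mulV_mul, h, mulV_one]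

lemma inner_le_dual {B : Matrix (Fin d) (Fin d) ℝ} (hB : B.PosDef)
    (u v : EuclideanSpace ℝ (Fin d)) : ⟪u, v⟫ ≤ dualNormB B u * normB B v := by
  obtain ⟨S, T, h1, h2, _, h4⟩ := exists_factor hB
  rw [normB_eq h1, dualNormB_eq h2, ← inner_factor h4]
  exact real_inner_le_norm _ _

lemma mulV_inv {B : Matrix (Fin d) (Fin d) ℝ} (hB : B.PosDef)
    (v : EuclideanSpace ℝ (Fin d)) : mulV B (mulV B⁻¹ v) = v := by
  have hu : IsUnit B.det := (Matrix.isUnit_iff_isUnit_det _).1 hB.isUnit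
  rw [← mulV_mul, Matrix.mul_nonsing_inv _ hu, mulV_one]

lemma normB_nonneg (B : Matrix (Fin d) (Fin d) ℝ) (v : EuclideanSpace ℝ (Fin d)) :
    0 ≤ normB B v := Real.sqrt_nonneg _

lemma dualNormB_nonneg (B : Matrix (Fin d) (Fin d) ℝ) (v : EuclideanSpace ℝ (Fin d)) :
    0 ≤ dualNormB B v := Real.sqrt_nonneg _

lemma normB_inv {B : Matrix (Fin d) (Fin d) ℝ} (hB : B.PosDef)
    (v : EuclideanSpace ℝ (Fin d)) : normB B (mulV B⁻¹ v) = dualNormB B v := by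
  rw [normB, dualNormB, mulV_inv hB, real_inner_comm]

lemma normB_le_of_loewner {H B : Matrix (Fin d) (Fin d) ℝ} (hH : H.PosDef) (hB : B.PosDef)
    {c : ℝ} (hc : 0 ≤ c) (h : (c • B - H).PosSemidef) (v : EuclideanSpace ℝ (Fin d)) :
    normB H v ≤ Real.sqrt c * normB B v := by
  have := psd_nonneg h v
  rw [mulV_sub_mat, mulV_smul_mat, inner_sub_right, inner_smul_right] at this
  rw [normB, normB, ← Real.sqrt_mul hc]
  exact Real.sqrt_le_sqrt (by linarith)

lemma dualNormB_le_of_loewner {H B : Matrix (Fin d) (Fin d) ℝ} (hH : H.PosDef) (hB : B.PosDef)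
    {c : ℝ} (hc : 0 ≤ c) (h : (c • B - H).PosSemidef) (v : EuclideanSpace ℝ (Fin d)) :
    dualNormB B v ≤ Real.sqrt c * dualNormB H v := by
  have h1 := inner_le_dual hH v (mulV B⁻¹ v)
  rw [← dualNormB_sq hB] at h1
  have h2 := normB_le_of_loewner hH hB hc h (mulV B⁻¹ v)
  rw [normB_inv hB] at h2
  have h3 := dualNormB_nonneg B v
  have h4 := dualNormB_nonneg H v
  have h5 := mul_le_mul_of_nonneg_left h2 h4
  rcases h3.eq_or_lt with h6 | h6
  · rw [← h6]; positivity
  · refine le_of_mul_le_mul_right ?_ h6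
    nlinarith

lemma dualNormB_diff {H B : Matrix (Fin d) (Fin d) ℝ} (hH : H.PosDef) (hB : B.PosDef)
    {a b α : ℝ} (hα : 0 < α) (ha : a ≤ α) (hb : b ≤ α)
    (h1 : (H - (1 - a) • B).PosSemidef) (h2 : ((1 + b) • B - H).PosSemidef)
    (v : EuclideanSpace ℝ (Fin d)) :
    dualNormB B (mulV (H - B) v) ≤ α * normB B v := by
  set y := mulV B⁻¹ (mulV (H - B) v) with hy
  have hN : dualNormB B (mulV (H - B) v) ^ 2 = ⟪mulV (H - B) v, y⟫ := dualNormB_sq hB _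
  have hN2 : dualNormB B (mulV (H - B) v) ^ 2 = ⟪y, mulV B y⟫ := by
    rw [hN, hy, mulV_inv hB, real_inner_comm]
  have hS : ⟪mulV (H - B) v, y⟫ = ⟪v, mulV (H - B) y⟫ := by
    have : (H - B).transpose = H - B := by
      have := (hH.isHermitian.sub hB.isHermitian).eq
      rwa [Matrix.conjTranspose_eq_transpose_of_trivial] at this
    rw [inner_mulV (H - B) v y, this]
  have hV := normB_sq hB.posSemidef v
  have k1 : ∀ w, ⟪w, mulV (H - B) w⟫ ≤ α * ⟪w, mulV B w⟫ := by
    intro w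
    have e1 := psd_nonneg h2 w
    have e3 := psd_nonneg hB.posSemidef w
    simp only [mulV_sub_mat, mulV_smul_mat, inner_sub_right, inner_smul_right] at e1 ⊢
    nlinarith
  have k2 : ∀ w, -(α * ⟪w, mulV B w⟫) ≤ ⟪w, mulV (H - B) w⟫ := by
    intro w
    have e1 := psd_nonneg h1 w
    have e3 := psd_nonneg hB.posSemidef w
    simp only [mulV_sub_mat, mulV_smul_mat, inner_sub_right, inner_smul_right] at e1 ⊢
    nlinarith
  replace k1 := k1 (α • v + y)
  replace k2 := k2 (α • v - y)
  have hS' : ⟪y, mulV (H - B) v⟫ = ⟪v, mulV (H - B) y⟫ := by rw [real_inner_comm, hS]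
  simp only [mulV_add, mulV_sub, mulV_smul, inner_add_left, inner_add_right, inner_sub_left,
    inner_sub_right, inner_smul_left, inner_smul_right, hS', ← hS, ← hN, ← hN2, ← hV,
    RCLike.conj_to_real] at k1 k2
  have : dualNormB B (mulV (H - B) v) ^ 2 ≤ (α * normB B v) ^ 2 := by
    nlinarith
  exact abs_le_of_sq_le_sq' this (by have := normB_nonneg B v; positivity) |>.2

end helpers

section analysis_part
variable {d : ℕ}

lemma hasGradient_of_C2 {f : EuclideanSpace ℝ (Fin d) → ℝ} (hC2 : ContDiff ℝ 2 f)
    (x : EuclideanSpace ℝ (Fin d)) : HasGradientAt f (gradient f x) x :=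
  (hC2.differentiable (by norm_num) x).hasGradientAt

lemma differentiable_gradient {f : EuclideanSpace ℝ (Fin d) → ℝ} (hC2 : ContDiff ℝ 2 f) :
    Differentiable ℝ (gradient f) := by
  have h1 : ContDiff ℝ 1 (fderiv ℝ f) := hC2.fderiv_right (by norm_num)
  have h2 : Differentiable ℝ (fderiv ℝ f) := h1.differentiable (by norm_num)
  have h3 : gradient f = fun x =>
      (InnerProductSpace.toDual ℝ (EuclideanSpace ℝ (Fin d))).symm (fderiv ℝ f x) := rfl
  rw [h3]
  exact (InnerProductSpace.toDual ℝ (EuclideanSpace ℝ (Fin d))).symm.toContinuousLinearEquiv.toContinuousLinearMap.differentiable.comp h2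

lemma hess_apply (f : EuclideanSpace ℝ (Fin d) → ℝ) (x v : EuclideanSpace ℝ (Fin d)) :
    mulV (hessM f x) v = fderiv ℝ (gradient f) x v := by
  have hv : v = ∑ j, v j • EuclideanSpace.single j (1 : ℝ) := by
    ext i
    simp [Finset.sum_apply, Pi.single_apply]
  conv_rhs => rw [hv]
  ext i
  simp [mulV_def, Matrix.mulVec, dotProduct, hessM, map_sum, mul_comm]

noncomputable def mulVL (A : Matrix (Fin d) (Fin d) ℝ) :
    EuclideanSpace ℝ (Fin d) →L[ℝ] EuclideanSpace ℝ (Fin d) :=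
  LinearMap.toContinuousLinearMap
    { toFun := mulV A
      map_add' := mulV_add A
      map_smul' := fun c v => mulV_smul A c v }

lemma mulVL_apply (A : Matrix (Fin d) (Fin d) ℝ) (v : EuclideanSpace ℝ (Fin d)) :
    mulVL A v = mulV A v := rfl

lemma normB_smul {B : Matrix (Fin d) (Fin d) ℝ} (hB : B.PosDef) {t : ℝ} (ht : 0 ≤ t)
    (v : EuclideanSpace ℝ (Fin d)) : normB B (t • v) = t * normB B v := by
  obtain ⟨S, T, h1, _⟩ := exists_factor hB
  rw [normB_eq h1, normB_eq h1, mulV_smul, norm_smul, Real.norm_of_nonneg ht]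

lemma taylor_grad {f : EuclideanSpace ℝ (Fin d) → ℝ} (hC2 : ContDiff ℝ 2 f)
    (hpd : ∀ x, (hessM f x).PosDef) {Ls : ℝ} (hssc : SemiStrongSelfConcordant f Ls)
    (x h : EuclideanSpace ℝ (Fin d)) :
    dualNormB (hessM f x) (gradient f (x + h) - gradient f x - mulV (hessM f x) h) ≤
      Ls / 2 * normB (hessM f x) h ^ 2 := by
  obtain ⟨S, T, h1, h2, _, _⟩ := exists_factor (hpd x)
  have hd := differentiable_gradient hC2
  set φ : ℝ → EuclideanSpace ℝ (Fin d) := fun t =>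
    mulVL T (gradient f (x + t • h) - gradient f x - t • mulV (hessM f x) h) with hφ
  have hder : ∀ t : ℝ, HasDerivAt φ
      (mulVL T (mulV (hessM f (x + t • h)) h - mulV (hessM f x) h)) t := by
    intro t
    have hl : HasDerivAt (fun t : ℝ => x + t • h) h t := by
      simpa using ((hasDerivAt_id t).smul_const h).const_add x
    have hg : HasDerivAt (fun t : ℝ => gradient f (x + t • h))
        (mulV (hessM f (x + t • h)) h) t := by
      rw [hess_apply]
      exact (hd (x + t • h)).hasFDerivAt.comp_hasDerivAt t hl
    have hm : HasDerivAt (fun t : ℝ => t • mulV (hessM f x) h) (mulV (hessM f x) h) t := by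
      simpa using (hasDerivAt_id t).smul_const (mulV (hessM f x) h)
    exact (mulVL T).hasFDerivAt.comp_hasDerivAt t ((hg.sub_const _).sub hm)
  have key := image_norm_le_of_norm_deriv_right_le_deriv_boundary (a := 0) (b := 1) (f := φ)
    (B := fun t => Ls / 2 * normB (hessM f x) h ^ 2 * t ^ 2)
    (B' := fun t => Ls * normB (hessM f x) h ^ 2 * t)
    (fun t _ => (hder t).continuousAt.continuousWithinAt)
    (fun t _ => (hder t).hasDerivWithinAt)
    (by simp [hφ])
    (by
      intro t
      have := (hasDerivAt_pow 2 t).const_mul (Ls / 2 * normB (hessM f x) h ^ 2)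
      refine HasDerivAt.congr_deriv this ?_
      norm_num
      ring)
    (by
      intro t ht
      have := hssc x (x + t • h) h
      rw [mulV_sub_mat, dualNormB_eq h2, add_sub_cancel_left, normB_smul (hpd x) ht.1] at this
      rw [mulVL_apply]
      refine this.trans (le_of_eq ?_)
      ring)
  have := key (Set.right_mem_Icc.2 zero_le_one)
  simp only [hφ, one_smul, mulVL_apply, one_pow, mul_one] at this
  rw [dualNormB_eq h2]
  exact this

lemma convex_grad {f : EuclideanSpace ℝ (Fin d) → ℝ} (hconv : ConvexOn ℝ Set.univ f)
    (hC2 : ContDiff ℝ 2 f) (x y : EuclideanSpace ℝ (Fin d)) :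
    f x + ⟪gradient f x, y - x⟫ ≤ f y := by
  have hc : ConvexOn ℝ Set.univ (f ∘ (AffineMap.lineMap x y : ℝ →ᵃ[ℝ] _)) := by
    simpa using hconv.comp_affineMap (AffineMap.lineMap x y : ℝ →ᵃ[ℝ] _)
  have hd : HasDerivAt (f ∘ (AffineMap.lineMap x y : ℝ →ᵃ[ℝ] _)) ⟪gradient f x, y - x⟫ 0 := by
    have hl : HasDerivAt (AffineMap.lineMap x y : ℝ → _) (y - x) 0 := AffineMap.hasDerivAt_lineMap
    have hg := (hasGradient_of_C2 hC2 x).hasFDerivAt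
    have h0 : x = (AffineMap.lineMap x y : ℝ → _) 0 := by simp
    have hg' : HasFDerivAt f (InnerProductSpace.toDual ℝ _ (gradient f x))
      ((AffineMap.lineMap x y : ℝ → _) 0) := by rw [← h0]; exact hg
    simpa using hg'.comp_hasDerivAt 0 hl
  have := hc.le_slope_of_hasDerivAt (Set.mem_univ 0) (Set.mem_univ 1) zero_lt_one hd
  rw [slope_def_field] at this
  simp only [Function.comp, AffineMap.lineMap_apply_zero, AffineMap.lineMap_apply_one, sub_zero,
    div_one] at this
  linarith

end analysis_part

lemma num_descent {L α r G q : ℝ} (hL : 0 < L) (hα : 0 < α) (hr : 0 ≤ r) (hG : 0 ≤ G)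
    (hq : G ^ 2 + 2 * (α + L * r) * q + (α + L * r) ^ 2 * r ^ 2 ≤ (α * r + L / 2 * r ^ 2) ^ 2)
    (hGα : 8 / 3 * α ^ 2 / L ≤ G) (w : ℝ) (hw : 0 ≤ w) (hwG : G = L * w ^ 2) :
    L * w ^ 3 / 3 ≤ -q := by
  have ha : α ≤ 5 / 8 * (L * w) := by
    rw [hwG, div_le_iff₀ hL] at hGα
    refine abs_le_of_sq_le_sq' ?_ (by positivity) |>.2
    nlinarith [sq_nonneg (L * w)]
  have hp : 0 < α + L * r := by positivity
  have h1 : 0 ≤ α * L * r ^ 3 := by positivity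
  have h2 : L ^ 2 * w ^ 4 + 3 / 4 * L ^ 2 * r ^ 4 ≤ 2 * (α + L * r) * (-q) := by
    rw [hwG] at hq
    nlinarith
  have h3 : 2 * (α + L * r) * (L * w ^ 3 / 3) ≤ L ^ 2 * w ^ 4 + 3 / 4 * L ^ 2 * r ^ 4 := by
    have : 2 * (α + L * r) * (L * w ^ 3 / 3) ≤ 2 * (5 / 8 * (L * w) + L * r) * (L * w ^ 3 / 3) := by
      gcongr
    have h4 : 2 * (5 / 8 * w + r) * (w ^ 3 / 3) ≤ w ^ 4 + 3 / 4 * r ^ 4 := by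
      nlinarith [sq_nonneg (r ^ 2 - 1 / 3 * w ^ 2), sq_nonneg (w * (r - 2 / 3 * w)), sq_nonneg (w ^ 2)]
    have h5 := mul_le_mul_of_nonneg_left h4 (sq_nonneg L)
    nlinarith
  have := h3.trans h2
  exact le_of_mul_le_mul_left this (by positivity)

lemma num_G {L α r G w : ℝ} (hL : 0 < L) (hα : 0 < α) (hr : 0 ≤ r)
    (hG : G ≤ 2 * α * r + 3 / 2 * L * r ^ 2)
    (hGα : 8 / 3 * α ^ 2 / L ≤ G) (hw : 0 ≤ w) (hwG : G = L * w ^ 2) : w ≤ 2 * r := by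
  by_contra! hc
  have ha : α ^ 2 ≤ 3 / 8 * (L * w) ^ 2 := by
    rw [hwG, div_le_iff₀ hL] at hGα
    nlinarith
  have ha : α ≤ 49 / 80 * (L * w) := by
    refine abs_le_of_sq_le_sq' ?_ (by positivity) |>.2
    nlinarith [sq_nonneg (L * w)]
  have hwp : 0 < w := by linarith
  have h1 : 2 * α * r ≤ 2 * (49 / 80 * (L * w)) * r := by gcongr
  have h2 : w ^ 2 ≤ 49 / 40 * w * r + 3 / 2 * r ^ 2 := by
    refine le_of_mul_le_mul_left ?_ hL
    nlinarith
  nlinarith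

lemma num_rate (s : ℕ → ℝ) (hs : ∀ j, 0 ≤ s j) (k : ℕ)
    (h1 : s 1 ≤ 2) (hstep : ∀ j, j ≤ k → s (j + 1) ^ 2 + s (j + 1) ^ 3 / 3 ≤ s j ^ 2) :
    ∀ j, j ≤ k → s (j + 1) ≤ 22 / ((j : ℝ) + 1) := by
  intro j
  induction j with
  | zero => intro _; norm_num; linarith
  | succ j ih =>
    intro hj
    have hi := ih (by omega)
    have hst := hstep (j + 1) hj
    by_contra! hc
    push_cast at hc
    have hj0 : (0 : ℝ) ≤ j := Nat.cast_nonneg j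
    set m : ℝ := (j : ℝ) + 1 with hm
    have hm1 : 1 ≤ m := by linarith
    have e0 : 0 < 22 / (m + 1) := by positivity
    have e1 : (22 / (m + 1)) ^ 2 + (22 / (m + 1)) ^ 3 / 3 < (22 / m) ^ 2 := by
      have a1 : (22 / (m + 1)) ^ 2 < s (j + 1 + 1) ^ 2 := by gcongr
      have a2 : (22 / (m + 1)) ^ 3 < s (j + 1 + 1) ^ 3 := by gcongr
      have a3 : s (j + 1) ^ 2 ≤ (22 / m) ^ 2 := by gcongr; exact hs _
      linarith
    have e2 : (22 / m) ^ 2 ≤ (22 / (m + 1)) ^ 2 + (22 / (m + 1)) ^ 3 / 3 := by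
      rw [div_pow, div_pow, div_pow, div_div, div_add_div _ _ (by positivity) (by positivity),
        div_le_div_iff₀ (by positivity) (by positivity)]
      have : 0 ≤ (m + 1) ^ 2 := by positivity
      have : 3 * (m + 1) ^ 3 ≤ m ^ 2 * (3 * (m + 1) + 22) := by nlinarith
      nlinarith
    linarith

lemma step_core {d : ℕ} {f : EuclideanSpace ℝ (Fin d) → ℝ}
    (hC2 : ContDiff ℝ 2 f)
    (hpd : ∀ x, (hessM f x).PosDef)
    {Ls : ℝ} (hLs : 0 < Ls) (hssc : SemiStrongSelfConcordant f Ls)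
    {al au α L : ℝ} (hα : 0 < α) (hαmax : max al au ≤ α)
    (hL : (1 + au) ^ ((3 : ℝ) / 2) * Ls ≤ L)
    {x y : EuclideanSpace ℝ (Fin d)} {B : Matrix (Fin d) (Fin d) ℝ} {η : ℝ}
    (hrel : RelInexactHessian f x al au B)
    (hη : 0 < η ∧ L * η ^ 2 * dualNormB B (gradient f x) + (1 + α) * η = 1)
    (hstep : y = x - η • mulV B⁻¹ (gradient f x)) :
    let r := normB B (y - x)
    let G := dualNormB B (gradient f y)
    r ≤ dualNormB B (gradient f x) ∧
    G ≤ 2 * α * r + 3 / 2 * L * r ^ 2 ∧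
    G ^ 2 + 2 * (α + L * r) * ⟪gradient f y, y - x⟫ + (α + L * r) ^ 2 * r ^ 2
      ≤ (α * r + L / 2 * r ^ 2) ^ 2 := by
  intro r G
  obtain ⟨_, _, hau, hB, hlo, hup⟩ := hrel
  obtain ⟨hη0, hη1⟩ := hη
  have hLpos : 0 < L := lt_of_lt_of_le (by positivity) hL
  set g := gradient f x with hg
  set h := y - x with hh
  have hhe : h = -(η • mulV B⁻¹ g) := by rw [hh, hstep]; abel
  have hr0 : 0 ≤ r := normB_nonneg _ _
  have hG0 := dualNormB_nonneg B g
  have hr : r = η * dualNormB B g := by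
    show normB B h = _
    have : normB B h = normB B (η • mulV B⁻¹ g) := by
      rw [hhe]
      obtain ⟨S, T, h1, _⟩ := exists_factor hB
      rw [normB_eq h1, normB_eq h1, ← norm_neg]
      congr 1
      rw [← neg_one_smul ℝ (η • mulV B⁻¹ g), mulV_smul, neg_one_smul, neg_neg]
    rw [this, normB_smul hB hη0.le, normB_inv hB]
  have hηr : η * (L * r + (1 + α)) = 1 := by rw [hr]; linarith [hη1]
  have hBh : mulV B h = -(η • g) := by
    rw [hhe, ← neg_one_smul ℝ (η • mulV B⁻¹ g), mulV_smul, mulV_smul, mulV_inv hB, neg_one_smul]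
  have hgB : g = -((L * r + (1 + α)) • mulV B h) := by
    rw [hBh, smul_neg, neg_neg, smul_smul, mul_comm, hηr, one_smul]
  have hη_le : η ≤ 1 := by
    nlinarith [mul_nonneg hη0.le (mul_nonneg hLpos.le hr0), mul_pos hη0 hα]
  have hT := taylor_grad hC2 hpd hssc x h
  have hxy : x + h = y := by rw [hh]; abel
  rw [hxy] at hT
  set H := hessM f x with hH
  have hc : (0 : ℝ) ≤ 1 + au := by linarith
  have t1 := dualNormB_le_of_loewner (hpd x) hB hc hup (gradient f y - g - mulV H h)
  have t2 := normB_le_of_loewner (hpd x) hB hc hup h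
  have t3 := dualNormB_diff (hpd x) hB hα ((le_max_left _ _).trans hαmax)
    ((le_max_right _ _).trans hαmax) hlo hup h
  have hpow : (1 + au) ^ ((3 : ℝ) / 2) = Real.sqrt (1 + au) ^ 3 := by
    rw [Real.sqrt_eq_rpow, ← Real.rpow_natCast, ← Real.rpow_mul hc]
    norm_num
  have hR : dualNormB B (gradient f y - g - mulV H h) ≤ L / 2 * r ^ 2 := by
    rw [hpow] at hL
    set c := Real.sqrt (1 + au)
    have hc0 : 0 ≤ c := Real.sqrt_nonneg _
    calc _ ≤ c * dualNormB H (gradient f y - g - mulV H h) := t1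
      _ ≤ c * (Ls / 2 * normB H h ^ 2) := by gcongr
      _ ≤ c * (Ls / 2 * (c * r) ^ 2) := by
          have := normB_nonneg H h
          gcongr
      _ = (c ^ 3 * Ls) / 2 * r ^ 2 := by ring
      _ ≤ L / 2 * r ^ 2 := by gcongr
  obtain ⟨S, T, h1, h2, h3, h4⟩ := exists_factor hB
  have hTB : mulV T (mulV B h) = mulV S h := by
    rw [h1, mulV_mul, ← mulV_mul T, h3, mulV_one]
  have hrS : r = ‖mulV S h‖ := normB_eq h1 h
  have hGT : G = ‖mulV T (gradient f y)‖ := dualNormB_eq h2 _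
  have hdec : mulV T (gradient f y) + (α + L * r) • mulV S h =
      mulV T (gradient f y - g - mulV H h) + mulV T (mulV (H - B) h) := by
    have : gradient f y + (α + L * r) • mulV B h
        = (gradient f y - g - mulV H h) + mulV (H - B) h := by
      rw [mulV_sub_mat]
      nth_rewrite 1 [hgB]
      module
    rw [← hTB, ← mulV_smul, ← mulV_add, this, mulV_add]
  have hnorm : ‖mulV T (gradient f y) + (α + L * r) • mulV S h‖ ≤ α * r + L / 2 * r ^ 2 := by
    rw [hdec]
    refine (norm_add_le _ _).trans ?_
    rw [← dualNormB_eq h2, ← dualNormB_eq h2]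
    have : dualNormB B (mulV (H - B) h) ≤ α * r := t3
    linarith
  refine ⟨?_, ?_, ?_⟩
  · rw [hr]; nlinarith
  · have : ‖mulV T (gradient f y)‖ ≤
        ‖mulV T (gradient f y) + (α + L * r) • mulV S h‖ + ‖(α + L * r) • mulV S h‖ := by
      simpa using norm_sub_le (mulV T (gradient f y) + (α + L * r) • mulV S h)
        ((α + L * r) • mulV S h)
    rw [norm_smul, ← hrS, ← hGT, Real.norm_of_nonneg (by positivity)] at this
    nlinarith
  · have e := pow_le_pow_left₀ (norm_nonneg _) hnorm 2
    rw [norm_add_sq_real, inner_smul_right, inner_factor h4, norm_smul, ← hrS, ← hGT,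
      Real.norm_of_nonneg (by positivity : 0 ≤ α + L * r)] at e
    refine le_trans (le_of_eq ?_) e
    ring

/-- `O(1/k²)` rate of CEQN while the gradients stay outside the region
`‖∇f(x_{j+1})‖_{B_j}^* ≤ (8/3)α²/L`. -/
theorem stmt8 {d : ℕ} (f : EuclideanSpace ℝ (Fin d) → ℝ)
    (hconv : ConvexOn ℝ Set.univ f) (hC2 : ContDiff ℝ 2 f)
    (hpd : ∀ x, (hessM f x).PosDef)
    (Ls : ℝ) (hLs : 0 < Ls) (hssc : SemiStrongSelfConcordant f Ls)
    (xs : EuclideanSpace ℝ (Fin d)) (hmin : ∀ y, f xs ≤ f y)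
    (al au α L : ℝ) (hα : 0 < α) (hαmax : max al au ≤ α)
    (hL : (1 + au) ^ ((3 : ℝ) / 2) * Ls ≤ L)
    (x : ℕ → EuclideanSpace ℝ (Fin d)) (B : ℕ → Matrix (Fin d) (Fin d) ℝ) (η : ℕ → ℝ)
    (hrel : ∀ j, RelInexactHessian f (x j) al au (B j))
    (hη : ∀ j, 0 < η j ∧
      L * η j ^ 2 * dualNormB (B j) (gradient f (x j)) + (1 + α) * η j = 1)
    (hstep : ∀ j, x (j + 1) = x j - η j • mulV (B j)⁻¹ (gradient f (x j)))
    (k : ℕ) (hk : 1 ≤ k)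
    (hgrad : ∀ j ≤ k, 8 / 3 * α ^ 2 / L ≤ dualNormB (B j) (gradient f (x (j + 1))))
    (Db : ℝ) (hDb : 0 < Db)
    (hD : ∀ j ≤ k + 1, normB (B j) (x j - xs) + dualNormB (B j) (gradient f (x j)) ≤ Db) :
    f (x (k + 1)) - f xs ≤ 486 * L * Db ^ 3 / (k : ℝ) ^ 2 := by
  have hau : 0 ≤ au := (hrel 0).2.2.1
  have hLpos : 0 < L := lt_of_lt_of_le (by positivity) hL
  have hLD : 0 < L * Db ^ 3 := by positivity
  -- per-step facts
  have main : ∀ j, j ≤ k → ∃ w : ℝ, 0 ≤ w ∧ w ≤ 2 * Db ∧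
      f (x (j + 1)) - f xs ≤ L * w ^ 2 * Db ∧
      L * w ^ 3 / 3 ≤ f (x j) - f (x (j + 1)) := by
    intro j hj
    obtain ⟨c1, c2, c3⟩ := step_core hC2 hpd hLs hssc hα hαmax hL (hrel j) (hη j) (hstep j)
    have hB : (B j).PosDef := (hrel j).2.2.2.1
    have hDj := hD j (by omega)
    have hr0 := normB_nonneg (B j) (x (j + 1) - x j)
    have hG0 := dualNormB_nonneg (B j) (gradient f (x (j + 1)))
    have hn0 := normB_nonneg (B j) (x j - xs)
    have hgj := hgrad j hj
    set r := normB (B j) (x (j + 1) - x j) with hr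
    set G := dualNormB (B j) (gradient f (x (j + 1))) with hG
    have hw0 := Real.sqrt_nonneg (G / L)
    have hwG : G = L * Real.sqrt (G / L) ^ 2 := by
      rw [Real.sq_sqrt (by positivity)]; field_simp
    set w := Real.sqrt (G / L) with hw
    have hw2 := num_G hLpos hα hr0 c2 hgj hw0 hwG
    have hds := num_descent hLpos hα hr0 hG0 c3 hgj w hw0 hwG
    refine ⟨w, hw0, by linarith, ?_, ?_⟩
    · have a1 := convex_grad hconv hC2 (x (j + 1)) xs
      have a2 := inner_le_dual hB (gradient f (x (j + 1))) (x (j + 1) - xs)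
      have a3 : normB (B j) (x (j + 1) - xs) ≤ r + normB (B j) (x j - xs) := by
        obtain ⟨S, T, h1, _⟩ := exists_factor hB
        rw [hr, normB_eq h1, normB_eq h1, normB_eq h1]
        have : x (j + 1) - xs = (x (j + 1) - x j) + (x j - xs) := by abel
        rw [this, mulV_add]
        exact norm_add_le _ _
      have a4 : ⟪gradient f (x (j + 1)), xs - x (j + 1)⟫
          = -⟪gradient f (x (j + 1)), x (j + 1) - xs⟫ := by
        rw [← inner_neg_right, neg_sub]
      have a5 : G * normB (B j) (x (j + 1) - xs) ≤ G * Db := by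
        gcongr; linarith
      rw [← hwG]
      linarith
    · have a1 := convex_grad hconv hC2 (x (j + 1)) (x j)
      have a4 : ⟪gradient f (x (j + 1)), x j - x (j + 1)⟫
          = -⟪gradient f (x (j + 1)), x (j + 1) - x j⟫ := by
        rw [← inner_neg_right, neg_sub]
      linarith
  set s : ℕ → ℝ := fun j => Real.sqrt ((f (x j) - f xs) / (L * Db ^ 3)) with hs
  have hs0 : ∀ j, 0 ≤ s j := fun j => Real.sqrt_nonneg _
  have hs2 : ∀ j, f (x j) - f xs = L * Db ^ 3 * s j ^ 2 := by
    intro j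
    have : 0 ≤ f (x j) - f xs := by linarith [hmin (x j)]
    simp only [hs]
    rw [Real.sq_sqrt (by positivity)]
    field_simp
  have hsw : ∀ j (w : ℝ), 0 ≤ w → f (x j) - f xs ≤ L * w ^ 2 * Db → s j * Db ≤ w := by
    intro j w hw h
    rw [hs2] at h
    have h' : (s j * Db) ^ 2 ≤ w ^ 2 := by
      refine le_of_mul_le_mul_left ?_ (mul_pos hLpos hDb)
      nlinarith
    exact (abs_le_of_sq_le_sq' h' hw).2
  have hrate := num_rate s hs0 k (by
      obtain ⟨w, w0, w1, w2, w3⟩ := main 0 (by omega)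
      have := hsw _ w w0 w2
      exact le_of_mul_le_mul_right (this.trans w1) hDb) (by
      intro j hj
      obtain ⟨w, w0, w1, w2, w3⟩ := main j hj
      have h1 := hsw _ w w0 w2
      have h2 : (s (j + 1) * Db) ^ 3 ≤ w ^ 3 :=
        pow_le_pow_left₀ (mul_nonneg (hs0 _) hDb.le) h1 3
      have h3 := mul_le_mul_of_nonneg_left h2 hLpos.le
      have h4 : f (x j) - f (x (j + 1)) = L * Db ^ 3 * s j ^ 2 - L * Db ^ 3 * s (j + 1) ^ 2 := by
        rw [← hs2, ← hs2]; ring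
      refine le_of_mul_le_mul_left ?_ hLD
      nlinarith) k le_rfl
  have hk0 : (0 : ℝ) < k := by exact_mod_cast hk
  have h1 : s (k + 1) ≤ 22 / (k : ℝ) := hrate.trans (by gcongr; linarith)
  have h2 : s (k + 1) ^ 2 ≤ 484 / (k : ℝ) ^ 2 := by
    have := pow_le_pow_left₀ (hs0 _) h1 2
    rw [div_pow] at this
    norm_num at this ⊢
    exact this
  rw [hs2]
  calc L * Db ^ 3 * s (k + 1) ^ 2 ≤ L * Db ^ 3 * (484 / (k : ℝ) ^ 2) := by gcongr
    _ = 484 * L * Db ^ 3 / (k : ℝ) ^ 2 := by ring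
    _ ≤ 486 * L * Db ^ 3 / (k : ℝ) ^ 2 := by gcongr; norm_num
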